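/- Let M=(Q,Σ,μ,F) be an accessible dwta over the commutative semifield S. Then two states q,p∈Q are weakly equivalent, q ∼_M p, if and only if for every context c∈C_Σ without states: h_μ^{(1)}(c[q]) ∈ F ⟺ h_μ^{(1)}(c[p]) ∈ F. -/

import Mathlib

open scoped BigOperators Classical

namespace WTA

/-- Trees over a ranked alphabet `Sig` (with arity map `ar`), indexed by states `Q`. -/
inductive PTree (Sig : Type) (ar : Sig → ℕ) (Q : Type) : Type where
  | state : Q → PTree Sig ar Q
  | node : (s : Sig) → (Fin (ar s) → PTree Sig ar Q) → PTree Sig ar Q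

/-- Contexts: trees with exactly one occurrence of the hole `□` at a leaf. -/
inductive Ctx (Sig : Type) (ar : Sig → ℕ) (Q : Type) : Type where
  | hole : Ctx Sig ar Q
  | node : (s : Sig) → (i : Fin (ar s)) → (Fin (ar s) → PTree Sig ar Q) →
      Ctx Sig ar Q → Ctx Sig ar Q

variable {Sig Q Q' S : Type} {ar : Sig → ℕ}

/-- Substitution `c[t]` of a tree into the hole of a context. -/
def Ctx.subst : Ctx Sig ar Q → PTree Sig ar Q → PTree Sig ar Q
  | .hole, t => t
  | .node s i ts c, t => .node s (Function.update ts i (c.subst t))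

/-- A closed tree (over `T_Σ`) viewed as a tree indexed by `Q`. -/
def PTree.ofClosed : PTree Sig ar Empty → PTree Sig ar Q
  | .state e => e.elim
  | .node s ts => .node s fun i => (ts i).ofClosed

/-- A closed context viewed as a context with states in `Q`. -/
def Ctx.ofClosed : Ctx Sig ar Empty → Ctx Sig ar Q
  | .hole => .hole
  | .node s i ts c => .node s i (fun j => (ts j).ofClosed) c.ofClosed

/-- Renaming of the states occurring in a tree. -/
def PTree.rename (g : Q → Q') : PTree Sig ar Q → PTree Sig ar Q'
  | .state p => .state (g p)
  | .node s ts => .node s fun i => (ts i).rename g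

/-- Renaming of the states occurring in a context. -/
def Ctx.rename (g : Q → Q') : Ctx Sig ar Q → Ctx Sig ar Q'
  | .hole => .hole
  | .node s i ts c => .node s i (fun j => (ts j).rename g) (c.rename g)

/-- The extension `h_μ` of the transition weight assignment `μ` to trees:
`h_μ(t → q)`. -/
noncomputable def hmu [Fintype Q] [CommSemiring S]
    (μ : ∀ s : Sig, (Fin (ar s) → Q) → Q → S) : PTree Sig ar Q → Q → S
  | .state p, q => if p = q then 1 else 0
  | .node s ts, q => ∑ qs : Fin (ar s) → Q, μ s qs q * ∏ i, hmu μ (ts i) (qs i)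

/-- The weighted tree language recognized by the wta `(Q, Σ, μ, F)`:
`M(t) = Σ_{q ∈ F} h_μ(t → q)`. -/
noncomputable def wtaSem [Fintype Q] [CommSemiring S]
    (μ : ∀ s : Sig, (Fin (ar s) → Q) → Q → S) (F : Finset Q)
    (t : PTree Sig ar Empty) : S :=
  ∑ q ∈ F, hmu μ (PTree.ofClosed t) q

/-- Bottom-up determinism: every left-hand side `σ(q₁,…,q_k)` has at most one
target state with nonzero weight. -/
def Deterministic [CommSemiring S] (μ : ∀ s : Sig, (Fin (ar s) → Q) → Q → S) : Prop :=
  ∀ (s : Sig) (qs : Fin (ar s) → Q) (q q' : Q), μ s qs q ≠ 0 → μ s qs q' ≠ 0 → q = q'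

/-- The pushed transition weight assignment
`μ'(σ(q₁,…,q_k) → q) = λ(q) · μ(σ(q₁,…,q_k) → q) · ∏ᵢ λ(qᵢ)⁻¹`. -/
noncomputable def push [Fintype Q] [Semifield S] (lam : Q → S)
    (μ : ∀ s : Sig, (Fin (ar s) → Q) → Q → S) :
    ∀ s : Sig, (Fin (ar s) → Q) → Q → S :=
  fun s qs q => lam q * μ s qs q * ∏ i, (lam (qs i))⁻¹

/-- `h_μ^{(1)}(t) ∈ F` (for a deterministic wta): some final state is reached
with nonzero weight. -/
def finReach [Fintype Q] [CommSemiring S]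
    (μ : ∀ s : Sig, (Fin (ar s) → Q) → Q → S) (F : Finset Q)
    (t : PTree Sig ar Q) : Prop :=
  ∃ q ∈ F, hmu μ t q ≠ 0

/-- `h_μ^{(2)}(t) · χ_F(h_μ^{(1)}(t))` (for a deterministic wta); an undefined
value counts as `0`. -/
noncomputable def cweight [Fintype Q] [CommSemiring S]
    (μ : ∀ s : Sig, (Fin (ar s) → Q) → Q → S) (F : Finset Q)
    (t : PTree Sig ar Q) : S :=
  ∑ q ∈ F, hmu μ t q

/-- `h_μ^{(2)}(t)` (for a deterministic wta); an undefined value counts as `0`. -/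
noncomputable def tweight [Fintype Q] [CommSemiring S]
    (μ : ∀ s : Sig, (Fin (ar s) → Q) → Q → S) (t : PTree Sig ar Q) : S :=
  ∑ q, hmu μ t q

/-- A context `c` is a sign of life for the state `q` if `h_μ^{(1)}(c[q]) ∈ F`. -/
def SignOfLife [Fintype Q] [CommSemiring S]
    (μ : ∀ s : Sig, (Fin (ar s) → Q) → Q → S) (F : Finset Q)
    (c : Ctx Sig ar Q) (q : Q) : Prop :=
  finReach μ F (c.subst (.state q))

/-- A state is live if it has a sign of life. -/
def Live [Fintype Q] [CommSemiring S]
    (μ : ∀ s : Sig, (Fin (ar s) → Q) → Q → S) (F : Finset Q) (q : Q) : Prop :=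
  ∃ c : Ctx Sig ar Q, SignOfLife μ F c q

/-- Weak equivalence `q₁ ∼_M q₂`. -/
def WeakEquiv [Fintype Q] [CommSemiring S]
    (μ : ∀ s : Sig, (Fin (ar s) → Q) → Q → S) (F : Finset Q)
    (q₁ q₂ : Q) : Prop :=
  ∀ c : Ctx Sig ar Q,
    finReach μ F (c.subst (.state q₁)) ↔ finReach μ F (c.subst (.state q₂))

/-- Myhill–Nerode equivalence `q₁ ≡_M q₂`: there is a nonzero factor `s` with
`h_μ^{(2)}(c[q₁])·χ_F(h_μ^{(1)}(c[q₁])) = s · h_μ^{(2)}(c[q₂])·χ_F(h_μ^{(1)}(c[q₂]))`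
for all contexts `c`. -/
def MNEquiv [Fintype Q] [CommSemiring S]
    (μ : ∀ s : Sig, (Fin (ar s) → Q) → Q → S) (F : Finset Q)
    (q₁ q₂ : Q) : Prop :=
  ∃ s : S, s ≠ 0 ∧ ∀ c : Ctx Sig ar Q,
    cweight μ F (c.subst (.state q₁)) = s * cweight μ F (c.subst (.state q₂))

/-- `r` is a congruence of the dwta: equivalent left-hand sides have equivalent
targets (`μ^{(1)}`-values), where two undefined values are regarded as
equivalent and an undefined value is never equivalent to a defined one. -/
def IsCongruence [Fintype Q] [CommSemiring S]
    (μ : ∀ s : Sig, (Fin (ar s) → Q) → Q → S) (r : Q → Q → Prop) : Prop :=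
  ∀ (s : Sig) (qs qs' : Fin (ar s) → Q), (∀ i, r (qs i) (qs' i)) →
    ((∃ q, μ s qs q ≠ 0) ↔ (∃ q, μ s qs' q ≠ 0)) ∧
    (∀ q q', μ s qs q ≠ 0 → μ s qs' q' ≠ 0 → r q q')

/-- `r` respects `F`: every class lies inside `F` or outside `F`. -/
def Respects (r : Q → Q → Prop) (F : Finset Q) : Prop :=
  ∀ q q', r q q' → (q ∈ F ↔ q' ∈ F)

/-- Accessibility: every state is reached by some (closed) tree. -/
def Accessible [Fintype Q] [CommSemiring S]
    (μ : ∀ s : Sig, (Fin (ar s) → Q) → Q → S) : Prop :=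
  ∀ q : Q, ∃ t : PTree Sig ar Empty, hmu μ (PTree.ofClosed t) q ≠ 0

/-- The transition weight assignment of the alphabetic dwta `syn(N)` over the
ranked alphabet `Σ × S` (where `⟨σ, s⟩` has the rank of `σ`):
`ν''(⟨σ,s⟩(q₁,…,q_k) → q) = 1` iff `ν(σ(q₁,…,q_k) → q) = s ≠ 0`. -/
noncomputable def synMu [Fintype Q] [CommSemiring S]
    (ν : ∀ s : Sig, (Fin (ar s) → Q) → Q → S) :
    ∀ p : Sig × S, (Fin ((fun p : Sig × S => ar p.1) p) → Q) → Q → S :=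
  fun p qs q => if ν p.1 qs q = p.2 ∧ p.2 ≠ 0 then 1 else 0

/-- Runs of the unweighted tree automaton `unw(M)` with transitions `supp(μ)`:
`Reach μ t q` iff `unw(M)` can reach state `q` on the tree `t`. -/
inductive Reach [CommSemiring S] (μ : ∀ s : Sig, (Fin (ar s) → Q) → Q → S) :
    PTree Sig ar Q → Q → Prop where
  | state (q : Q) : Reach μ (.state q) q
  | node {s : Sig} (ts : Fin (ar s) → PTree Sig ar Q) (qs : Fin (ar s) → Q) (q : Q)
      (h : μ s qs q ≠ 0) (hc : ∀ i, Reach μ (ts i) (qs i)) : Reach μ (.node s ts) q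

/-- Provided every child reaches at most one state, a node reaches `q` iff some transition into
`q` has a left-hand side whose states are reached by the children. -/
theorem hmu_node_ne_zero_iff_of_unique [Fintype Q] [Semifield S]
    (μ : ∀ s : Sig, (Fin (ar s) → Q) → Q → S) {s : Sig} {ts : Fin (ar s) → PTree Sig ar Q}
    (hts : ∀ i q q', hmu μ (ts i) q ≠ 0 → hmu μ (ts i) q' ≠ 0 → q = q') (q : Q) :
    hmu μ (.node s ts) q ≠ 0 ↔
      ∃ qs : Fin (ar s) → Q, μ s qs q ≠ 0 ∧ ∀ i, hmu μ (ts i) (qs i) ≠ 0 := by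
  rw [hmu]
  constructor
  · intro h
    obtain ⟨qs, -, hqs⟩ := Finset.exists_ne_zero_of_sum_ne_zero h
    exact ⟨qs, left_ne_zero_of_mul hqs,
      fun i => Finset.prod_ne_zero_iff.1 (right_ne_zero_of_mul hqs) i (Finset.mem_univ i)⟩
  · rintro ⟨qs, hμ, hqs⟩
    rw [Finset.sum_eq_single qs]
    · exact mul_ne_zero hμ (Finset.prod_ne_zero_iff.2 fun i _ => hqs i)
    · intro qs' _ hne
      by_contra h
      exact hne <| funext fun i => hts i _ _
        (Finset.prod_ne_zero_iff.1 (right_ne_zero_of_mul h) i (Finset.mem_univ i)) (hqs i)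
    · exact fun h => absurd (Finset.mem_univ _) h

/-- In a dwta every tree reaches at most one state. -/
theorem Deterministic.hmu_unique [Fintype Q] [Semifield S]
    {μ : ∀ s : Sig, (Fin (ar s) → Q) → Q → S} (hdet : Deterministic μ) (t : PTree Sig ar Q) :
    ∀ q q', hmu μ t q ≠ 0 → hmu μ t q' ≠ 0 → q = q' := by
  induction t with
  | state p =>
    intro q q' h h'
    simp only [hmu, ne_eq, ite_eq_right_iff, one_ne_zero, imp_false, not_not] at h h'
    exact h.symm.trans h'
  | node s ts ih =>
    intro q q' h h'
    obtain ⟨qs, hμ, hqs⟩ := (hmu_node_ne_zero_iff_of_unique μ ih q).1 h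
    obtain ⟨qs', hμ', hqs'⟩ := (hmu_node_ne_zero_iff_of_unique μ ih q').1 h'
    obtain rfl : qs = qs' := funext fun i => ih i _ _ (hqs i) (hqs' i)
    exact hdet s qs q q' hμ hμ'

/-- In a dwta, a node reaches `q` iff some transition into `q` has a left-hand side whose states
are reached by the children. -/
theorem Deterministic.hmu_node_ne_zero_iff [Fintype Q] [Semifield S]
    {μ : ∀ s : Sig, (Fin (ar s) → Q) → Q → S} (hdet : Deterministic μ) {s : Sig}
    (ts : Fin (ar s) → PTree Sig ar Q) (q : Q) :
    hmu μ (.node s ts) q ≠ 0 ↔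
      ∃ qs : Fin (ar s) → Q, μ s qs q ≠ 0 ∧ ∀ i, hmu μ (ts i) (qs i) ≠ 0 :=
  hmu_node_ne_zero_iff_of_unique μ (fun i => hdet.hmu_unique (ts i)) q

/-- In an accessible dwta, every tree that reaches a state can be replaced by a closed tree. -/
theorem Deterministic.exists_closed_tree [Fintype Q] [Semifield S]
    {μ : ∀ s : Sig, (Fin (ar s) → Q) → Q → S} (hdet : Deterministic μ) (hacc : Accessible μ)
    {t : PTree Sig ar Q} (ht : ∃ q, hmu μ t q ≠ 0) :
    ∃ t' : PTree Sig ar Empty, ∀ q, hmu μ t q ≠ 0 ↔ hmu μ t'.ofClosed q ≠ 0 := by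
  obtain ⟨p, hp⟩ := ht
  obtain ⟨t', ht'⟩ := hacc p
  refine ⟨t', fun q => ⟨fun h => ?_, fun h => ?_⟩⟩
  · exact hdet.hmu_unique t p q hp h ▸ ht'
  · exact hdet.hmu_unique _ p q ht' h ▸ hp

/-- In an accessible dwta, every context either never reaches a state or can be replaced by a
closed context. -/
theorem Deterministic.exists_closed_context [Fintype Q] [Nonempty Q] [Semifield S]
    {μ : ∀ s : Sig, (Fin (ar s) → Q) → Q → S} (hdet : Deterministic μ) (hacc : Accessible μ)
    (c : Ctx Sig ar Q) :
    (∀ t q, hmu μ (c.subst t) q = 0) ∨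
      ∃ c' : Ctx Sig ar Empty, ∀ t q,
        hmu μ (c.subst t) q ≠ 0 ↔ hmu μ ((Ctx.ofClosed c').subst t) q ≠ 0 := by
  induction c with
  | hole => exact .inr ⟨.hole, fun t q => Iff.rfl⟩
  | node s i ts c ih =>
    by_cases hts : ∀ j, j ≠ i → ∃ q, hmu μ (ts j) q ≠ 0
    · rcases ih with hdead | ⟨c', hc'⟩
      · left
        intro t q
        by_contra h
        obtain ⟨qs, -, hqs⟩ := (hdet.hmu_node_ne_zero_iff _ q).1 h
        exact hqs i (by simpa using hdead t (qs i))
      · right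
        have hex : ∀ j, ∃ t' : PTree Sig ar Empty, j ≠ i →
            ∀ q, hmu μ (ts j) q ≠ 0 ↔ hmu μ t'.ofClosed q ≠ 0 := by
          intro j
          by_cases hj : j = i
          · obtain ⟨t', -⟩ := hacc (Classical.arbitrary Q)
            exact ⟨t', fun h => absurd hj h⟩
          · obtain ⟨t', ht'⟩ := hdet.exists_closed_tree hacc (hts j hj)
            exact ⟨t', fun _ => ht'⟩
        choose ts' hts' using hex
        refine ⟨.node s i ts' c', fun t q => ?_⟩
        simp only [Ctx.ofClosed, Ctx.subst]
        rw [hdet.hmu_node_ne_zero_iff, hdet.hmu_node_ne_zero_iff]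
        refine exists_congr fun qs => and_congr_right fun _ => forall_congr' fun j => ?_
        by_cases hj : j = i
        · subst hj
          simpa only [Function.update_self] using hc' t (qs j)
        · simpa only [Function.update_of_ne hj] using hts' j hj (qs j)
    · left
      push Not at hts
      obtain ⟨j, hj, hdead⟩ := hts
      intro t q
      by_contra h
      obtain ⟨qs, -, hqs⟩ := (hdet.hmu_node_ne_zero_iff _ q).1 h
      exact hqs j (by simpa only [Function.update_of_ne hj] using hdead (qs j))

/-- In an accessible dwta, two states are weakly equivalent
iff they behave identically on all contexts `c ∈ C_Σ` without states. -/
theorem weakEquiv_iff_closed_contexts {Sig Q S : Type} {ar : Sig → ℕ}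
    [Fintype Q] [Semifield S]
    (μ : ∀ s : Sig, (Fin (ar s) → Q) → Q → S) (F : Finset Q)
    (hdet : Deterministic μ) (hacc : Accessible μ) :
    ∀ q p : Q, WeakEquiv μ F q p ↔
      ∀ c : Ctx Sig ar Empty,
        (finReach μ F ((Ctx.ofClosed c).subst (.state q)) ↔
         finReach μ F ((Ctx.ofClosed c).subst (.state p))) := by
  intro q p
  refine ⟨fun h c => h (Ctx.ofClosed c), fun h c => ?_⟩
  have : Nonempty Q := ⟨q⟩
  rcases hdet.exists_closed_context hacc c with hdead | ⟨c', hc'⟩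
  · simp [finReach, hdead]
  · simpa only [finReach, hc'] using h c'

end WTA
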